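/- Let D < 0 be a fundamental discriminant, K = Q(√D). The map sending a reduced positive definite form (a,b,c) of discriminant D to the class of the ideal Z·((−b+√D)/2) + Z·a is a bijection between reduced forms of discriminant D and the ideal class group Cl_K of K. -/

import Mathlib

open NumberField
open scoped nonZeroDivisors

/-- A fundamental discriminant: either `D ≡ 1 (mod 4)` and squarefree, or `D ≡ 0 (mod 4)`,
`D/4` squarefree and `D/4 ≡ 2, 3 (mod 4)`. -/
def IsFundamentalDiscriminant (D : ℤ) : Prop :=
  (D % 4 = 1 ∧ Squarefree D) ∨
    (D % 4 = 0 ∧ Squarefree (D / 4) ∧ (D / 4 % 4 = 2 ∨ D / 4 % 4 = 3))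

/-- A reduced positive definite integral binary quadratic form `(a,b,c)` of
discriminant `D`: `a > 0`, `b² - 4ac = D`, `|b| ≤ a ≤ c`, with `b ≥ 0` whenever
`|b| = a` or `a = c`. -/
def IsReducedForm (D : ℤ) (f : ℤ × ℤ × ℤ) : Prop :=
  0 < f.1 ∧ |f.2.1| ≤ f.1 ∧ f.1 ≤ f.2.2 ∧ f.2.1 ^ 2 - 4 * f.1 * f.2.2 = D ∧
    ((|f.2.1| = f.1 ∨ f.1 = f.2.2) → 0 ≤ f.2.1)

theorem reduced_le_value {a b c p r : ℤ} (ha : 0 < a) (hb : |b| ≤ a) (hc : a ≤ c)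
    (h : p ≠ 0 ∨ r ≠ 0) : a ≤ a * p ^ 2 + b * p * r + c * r ^ 2 := by
  obtain ⟨h1, h2⟩ := abs_le.mp hb
  have key : 1 ≤ p ^ 2 - |p * r| + r ^ 2 := by
    have h4 : 0 < p ^ 2 + r ^ 2 := by
      rcases h with h | h
      · have := pow_pos (abs_pos.mpr h) 2; rw [sq_abs] at this; nlinarith [sq_nonneg r]
      · have := pow_pos (abs_pos.mpr h) 2; rw [sq_abs] at this; nlinarith [sq_nonneg p]
    rcases abs_cases (p * r) with ⟨h5, _⟩ | ⟨h5, _⟩ <;> rw [h5] <;>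
      nlinarith [sq_nonneg (p - r), sq_nonneg (p + r)]
  have hbp : -(a * |p * r|) ≤ b * (p * r) := by
    have := neg_abs_le (b * (p * r))
    rw [abs_mul] at this
    nlinarith [abs_nonneg (p * r)]
  nlinarith [sq_nonneg r]

/-- If a reduced form represents its leading coefficient `a` at `(p, r)` with `r ≠ 0`,
then `a = c`. -/
theorem reduced_eq_of_value_eq {a b c p r : ℤ} (ha : 0 < a) (hb : |b| ≤ a) (hc : a ≤ c)
    (hr : r ≠ 0) (h : a * p ^ 2 + b * p * r + c * r ^ 2 = a) : a = c := by
  have h1 := reduced_le_value ha hb le_rfl (p := p) (Or.inr hr)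
  have h2 : 0 < r ^ 2 := by positivity
  nlinarith

/-- Two reduced forms of the same discriminant that are intertwined by a unimodular matrix
agree. -/
theorem reduced_unique {a b c a' b' c' p q r s : ℤ}
    (ha : 0 < a) (hb : |b| ≤ a) (hc : a ≤ c) (hbd : (|b| = a ∨ a = c) → 0 ≤ b)
    (ha' : 0 < a') (hb' : |b'| ≤ a') (hc' : a' ≤ c') (hbd' : (|b'| = a' ∨ a' = c') → 0 ≤ b')
    (hdisc : b ^ 2 - 4 * a * c = b' ^ 2 - 4 * a' * c')
    (hdet : IsUnit (p * s - q * r))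
    (h1 : 2 * a * p + b * r = 2 * a' * s - b' * r)
    (h2 : 2 * a * q + b * s = b' * s - 2 * c' * r)
    (h3 : -b * p - 2 * c * r = 2 * a' * q - b' * p)
    (h4 : -b * q - 2 * c * s = b' * q - 2 * c' * p) : a = a' ∧ b = b' ∧ c = c' := by
  have hv : a' * (p * s - q * r) = a * p ^ 2 + b * p * r + c * r ^ 2 := by
    refine mul_left_cancel₀ (two_ne_zero (α := ℤ)) ?_
    linear_combination -p * h1 + r * h3
  have hv' : a * (p * s - q * r) = a' * s ^ 2 + b' * s * (-r) + c' * (-r) ^ 2 := by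
    refine mul_left_cancel₀ (two_ne_zero (α := ℤ)) ?_
    linear_combination s * h1 - r * h2
  have hpr : p ≠ 0 ∨ r ≠ 0 := by
    by_contra! h
    simp [h.1, h.2] at hdet
  have hsr : s ≠ 0 ∨ -r ≠ 0 := by
    by_contra! h
    simp [h.1, neg_eq_zero.mp h.2] at hdet
  have l1 := reduced_le_value ha hb hc hpr
  have l2 := reduced_le_value ha' hb' hc' hsr
  have hdet1 : p * s - q * r = 1 := by
    rcases Int.isUnit_iff.mp hdet with h | h
    · exact h
    · rw [h] at hv; linarith
  rw [hdet1] at hv hv'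
  have haa : a = a' := by linarith
  subst haa
  have hbb : b = b' := by
    by_cases hr : r = 0
    · subst hr
      have hs : s ≠ 0 := by simpa using hsr
      have hk : b' - b = 2 * a * (q * p) := by
        have hps : p = s := by
          have : 2 * a * (p - s) = 0 := by linarith
          rcases mul_eq_zero.mp this with h | h <;> linarith
        subst hps
        have hp : p * p = 1 := by linarith
        linear_combination (b - b') * hp - p * h2
      obtain ⟨u1, u2⟩ := abs_le.mp hb
      obtain ⟨v1, v2⟩ := abs_le.mp hb'
      generalize q * p = k at hk
      have hk1 : k ≤ 1 := by nlinarith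
      have hk2 : -1 ≤ k := by nlinarith
      have : k = -1 ∨ k = 0 ∨ k = 1 := by omega
      rcases this with rfl | rfl | rfl
      · have e : b' = -a := by linarith
        have := hbd' (Or.inl (by rw [e, abs_neg, abs_of_pos ha]))
        linarith
      · linarith
      · have e : b = -a := by linarith
        have := hbd (Or.inl (by rw [e, abs_neg, abs_of_pos ha]))
        linarith
    · have e1 := reduced_eq_of_value_eq ha hb hc hr (hv.symm.trans (mul_one a))
      have e2 := reduced_eq_of_value_eq ha hb' hc' (neg_ne_zero.mpr hr)
        (hv'.symm.trans (mul_one a))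
      have n1 := hbd (Or.inr e1)
      have n2 := hbd' (Or.inr e2)
      subst e1
      rw [← e2] at hdisc
      exact (sq_eq_sq₀ n1 n2).mp (by linarith)
  subst hbb
  refine ⟨rfl, rfl, ?_⟩
  have : 4 * a * (c - c') = 0 := by linarith
  rcases mul_eq_zero.mp this with h | h <;> linarith

theorem Rat.exists_int_eq_of_sq_mul_squarefree {d N : ℤ} (hd : Squarefree d) {u : ℚ}
    (h : u ^ 2 * d = N) : ∃ n : ℤ, u = n := by
  have hden : (u.den : ℚ) ≠ 0 := by exact_mod_cast u.den_ne_zero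
  have h1 : u.num ^ 2 * d = N * (u.den : ℤ) ^ 2 := by
    have : ((u.num : ℚ)) ^ 2 * d = N * (u.den : ℚ) ^ 2 := by
      rw [← h]
      nth_rw 2 [← Rat.num_div_den u]
      field_simp
    exact_mod_cast this
  have hcop : IsCoprime ((u.den : ℤ) ^ 2) (u.num ^ 2) := by
    apply IsCoprime.pow
    rw [Int.isCoprime_iff_gcd_eq_one, Int.gcd_comm]
    simpa [Int.gcd] using u.reduced
  have h2 : (u.den : ℤ) * u.den ∣ d := by
    rw [← sq]
    exact hcop.dvd_of_dvd_mul_left (Dvd.intro_left _ h1.symm)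
  have h3 := hd _ h2
  refine ⟨u.num, ?_⟩
  have : u.den = 1 := by simpa using Int.isUnit_iff_natAbs_eq.mp h3
  exact ((Rat.den_eq_one_iff u).mp this).symm

theorem eq_zero_of_int_mul_eq_int {R : Type*} [CommRing R] [CharZero R] {D : ℤ} (hD : D < 0)
    {δ : R} (hδ : δ ^ 2 = (D : R)) {u v : ℤ} (h : (u : R) * δ = v) : u = 0 ∧ v = 0 := by
  have h1 : u ^ 2 * D = v ^ 2 := by
    have : ((u ^ 2 * D : ℤ) : R) = ((v ^ 2 : ℤ) : R) := by
      push_cast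
      rw [← h, ← hδ]
      ring
    exact_mod_cast this
  have hu : u = 0 := by
    by_contra hu
    have : 0 < u ^ 2 := by positivity
    nlinarith [sq_nonneg v]
  subst hu
  exact ⟨rfl, by simpa using h1.symm⟩

section Integers

variable {K : Type*} [Field K] [NumberField K]

/-- An algebraic integer `x = p + q δ` in a quadratic field, `δ² = D < 0`, has integral trace
`2 p` and integral norm `p² - q² D`. -/
theorem exists_coords_of_quadratic (hdeg : Module.finrank ℚ K = 2) {D : ℤ} (hD : D < 0)
    {δ : K} (hδ : δ ^ 2 = (D : K)) (x : 𝓞 K) :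
    ∃ p q : ℚ, (x : K) = p + q * δ ∧ (∃ t : ℤ, 2 * p = t) ∧ ∃ N : ℤ, p ^ 2 - q ^ 2 * D = N := by
  have : Algebra.IsQuadraticExtension ℚ K := { finrank_eq_two' := hdeg }
  have hnot : ∀ r : ℚ, (r : K) ≠ δ := by
    rintro r rfl
    have h : r ^ 2 = (D : ℚ) := by exact_mod_cast hδ
    have : (D : ℚ) < 0 := by exact_mod_cast hD
    nlinarith [sq_nonneg r]
  have hli : LinearIndependent ℚ ![(1 : K), δ] := by
    rw [LinearIndependent.pair_iff' one_ne_zero]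
    intro r hr
    exact hnot r (by rw [← hr, Algebra.smul_def, mul_one, eq_ratCast])
  have hspan := hli.span_eq_top_of_card_eq_finrank' (by simp [hdeg])
  have hx : (x : K) ∈ Submodule.span ℚ (Set.range ![(1 : K), δ]) := hspan ▸ Submodule.mem_top
  rw [Matrix.range_cons, Matrix.range_cons, Matrix.range_empty, Set.union_empty,
    Set.singleton_union, Submodule.mem_span_pair] at hx
  obtain ⟨p, q, hpq⟩ := hx
  simp only [Algebra.smul_def, mul_one, eq_ratCast] at hpq
  obtain ⟨σ, hσ⟩ : ∃ σ : Gal(K/ℚ), σ δ ≠ δ := by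
    by_contra! h
    obtain ⟨r, hr⟩ := IntermediateField.mem_bot.mp ((IsGalois.mem_bot_iff_fixed δ).mpr h)
    exact hnot r (by rw [← hr, eq_ratCast])
  have hσδ : σ δ = -δ := by
    have : (σ δ) ^ 2 = δ ^ 2 := by rw [← map_pow, hδ, map_intCast]
    exact (sq_eq_sq_iff_eq_or_eq_neg.mp this).resolve_left hσ
  have hσx : σ x = p - q * δ := by
    rw [← hpq, map_add, map_mul, hσδ, map_ratCast, map_ratCast]
    ring
  have hint : IsIntegral ℤ (x : K) := x.isIntegral_coe
  have hintσ : IsIntegral ℤ (σ x) := hint.map (σ : K →ₐ[ℚ] K)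
  have key : ∀ r : ℚ, IsIntegral ℤ (r : K) → ∃ n : ℤ, r = n := by
    intro r hr
    have h : IsIntegral ℤ r := by
      rw [← eq_ratCast (algebraMap ℚ K)] at hr
      exact (isIntegral_algebraMap_iff (algebraMap ℚ K).injective).mp hr
    obtain ⟨n, hn⟩ := IsIntegrallyClosed.isIntegral_iff.mp h
    exact ⟨n, by simpa using hn.symm⟩
  refine ⟨p, q, hpq.symm, key _ ?_, key _ ?_⟩
  · have h : ((2 * p : ℚ) : K) = x + σ x := by
      rw [hσx, ← hpq]
      push_cast
      ring
    exact h ▸ hint.add hintσ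
  · have h : ((p ^ 2 - q ^ 2 * D : ℚ) : K) = x * σ x := by
      rw [hσx, ← hpq]
      push_cast
      rw [← hδ]
      ring
    exact h ▸ hint.mul hintσ

theorem exists_integral_generator (hdeg : Module.finrank ℚ K = 2) {D : ℤ} (hD : D < 0)
    (hfund : IsFundamentalDiscriminant D) {δ : 𝓞 K} (hδ : δ ^ 2 = (D : 𝓞 K)) :
    ∃ (b N : ℤ) (w : 𝓞 K), 2 * w = -(b : 𝓞 K) + δ ∧ b ^ 2 - 4 * N = D ∧
      ∀ x : 𝓞 K, ∃ m n : ℤ, x = m + n * w := by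
  have hδK : (δ : K) ^ 2 = (D : K) := by
    rw [← map_pow, hδ, map_intCast]
  have hw : ∀ b N : ℤ, b ^ 2 - 4 * N = D → ∃ w : 𝓞 K, 2 * w = -(b : 𝓞 K) + δ := by
    intro b N h
    have hD' : (D : K) = b ^ 2 - 4 * N := by rw [← h]; push_cast; ring
    have : IsIntegral ℤ ((-(b : K) + δ) / 2) := by
      refine ⟨.X ^ 2 + (.C b * .X + .C N), ?_, ?_⟩
      · exact Polynomial.monic_X_pow_add (by
          refine lt_of_le_of_lt Polynomial.degree_linear_le (by norm_num))
      · rw [Polynomial.eval₂_add, Polynomial.eval₂_add, Polynomial.eval₂_mul,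
          Polynomial.eval₂_pow, Polynomial.eval₂_X, Polynomial.eval₂_C, Polynomial.eval₂_C,
          eq_intCast, eq_intCast]
        linear_combination (hδK + hD') / 4
    obtain ⟨w, hw⟩ : ∃ w : 𝓞 K, (w : K) = (-(b : K) + δ) / 2 := ⟨⟨_, this⟩, rfl⟩
    refine ⟨w, RingOfIntegers.ext ?_⟩
    change algebraMap (𝓞 K) K (2 * w) = algebraMap (𝓞 K) K (-(b : 𝓞 K) + δ)
    rw [map_mul, map_ofNat, map_add, map_neg, map_intCast]
    rw [RingOfIntegers.coe_eq_algebraMap] at hw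
    rw [hw, RingOfIntegers.coe_eq_algebraMap]
    ring
  rcases hfund with ⟨hD4, hsq⟩ | ⟨hD4, hsq, hd⟩
  · obtain ⟨N, hN⟩ : ∃ N : ℤ, 1 ^ 2 - 4 * N = D := ⟨(1 - D) / 4, by omega⟩
    obtain ⟨w, hwb⟩ := hw 1 N hN
    refine ⟨1, N, w, hwb, hN, fun x => ?_⟩
    obtain ⟨p, q, hx, ⟨t, ht⟩, M, hM⟩ := exists_coords_of_quadratic hdeg hD hδK x
    have h1 : (2 * q) ^ 2 * D = ((t ^ 2 - 4 * M : ℤ) : ℚ) := by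
      push_cast
      linear_combination (2 * p + t) * ht - 4 * hM
    obtain ⟨u, hu⟩ := Rat.exists_int_eq_of_sq_mul_squarefree hsq h1
    rw [hu] at h1
    have h2 : u ^ 2 * D = t ^ 2 - 4 * M := by exact_mod_cast h1
    obtain ⟨k, hk⟩ : (2 : ℤ) ∣ t + u := by
      have : Even (t ^ 2 + u ^ 2 ) := ⟨2 * M + u ^ 2 * (1 - 2 * N), by rw [← hN] at h2; linarith⟩
      have h3 : Even ((t + u) ^ 2) := by
        have e : (t + u) ^ 2 = t ^ 2 + u ^ 2 + 2 * (t * u) := by ring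
        exact e ▸ this.add (even_two_mul (t * u))
      exact (Int.even_pow.mp h3).1.two_dvd
    refine ⟨k, u, ?_⟩
    refine RingOfIntegers.ext ?_
    have hwK : 2 * (w : K) = -1 + δ := by
      have := congrArg (algebraMap (𝓞 K) K) hwb
      rwa [map_mul, map_ofNat, map_add, map_neg, map_intCast, Int.cast_one] at this
    have htK : 2 * (p : K) = t := by exact_mod_cast congrArg (Rat.cast (K := K)) ht
    have huK : 2 * (q : K) = u := by exact_mod_cast congrArg (Rat.cast (K := K)) hu
    have hkK : (t : K) + u = 2 * k := by exact_mod_cast congrArg (Int.cast (R := K)) hk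
    simp only [map_add, map_mul, map_intCast]
    rw [hx]
    refine mul_left_cancel₀ (two_ne_zero (α := K)) ?_
    linear_combination htK + δ * huK - u * hwK + hkK
  · obtain ⟨d, rfl⟩ : ∃ d : ℤ, D = 4 * d := ⟨D / 4, by omega⟩
    rw [Int.mul_ediv_cancel_left _ (by norm_num)] at hsq hd
    have hN : (0 : ℤ) ^ 2 - 4 * (-d) = 4 * d := by ring
    obtain ⟨w, hwb⟩ := hw 0 (-d) hN
    refine ⟨0, -d, w, hwb, hN, fun x => ?_⟩
    obtain ⟨p, q, hx, ⟨t, ht⟩, M, hM⟩ := exists_coords_of_quadratic hdeg hD hδK x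
    push_cast at hM
    have h1 : (4 * q) ^ 2 * d = ((t ^ 2 - 4 * M : ℤ) : ℚ) := by
      push_cast
      linear_combination (2 * p + t) * ht - 4 * hM
    obtain ⟨v, hv⟩ := Rat.exists_int_eq_of_sq_mul_squarefree hsq h1
    rw [hv] at h1
    have h2 : v ^ 2 * d = t ^ 2 - 4 * M := by exact_mod_cast h1
    obtain ⟨⟨k, hk⟩, l, hl⟩ : (2 : ℤ) ∣ t ∧ (2 : ℤ) ∣ v := by
      obtain ⟨e, he⟩ : ∃ e, d = 4 * e + 2 ∨ d = 4 * e + 3 := ⟨d / 4, by omega⟩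
      obtain ⟨k, hk⟩ := Int.even_or_odd' t
      obtain ⟨l, hl⟩ := Int.even_or_odd' v
      rcases hk with rfl | rfl <;> rcases hl with rfl | rfl <;> rcases he with rfl | rfl <;>
        ring_nf at h2 <;> omega
    refine ⟨k, l, ?_⟩
    refine RingOfIntegers.ext ?_
    have hwK : 2 * (w : K) = δ := by
      have := congrArg (algebraMap (𝓞 K) K) hwb
      rwa [map_mul, map_ofNat, map_add, map_neg, map_intCast, Int.cast_zero, neg_zero,
        zero_add] at this
    have htK : 2 * (p : K) = t := by exact_mod_cast congrArg (Rat.cast (K := K)) ht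
    have hvK : 4 * (q : K) = v := by exact_mod_cast congrArg (Rat.cast (K := K)) hv
    have hkK : (t : K) = 2 * k := by exact_mod_cast congrArg (Int.cast (R := K)) hk
    have hlK : (v : K) = 2 * l := by exact_mod_cast congrArg (Int.cast (R := K)) hl
    simp only [map_add, map_mul, map_intCast]
    rw [hx]
    refine mul_left_cancel₀ (show (4 : K) ≠ 0 by norm_num) ?_
    linear_combination 2 * htK + δ * hvK - 2 * l * hwK + 2 * hkK + δ * hlK

end Integers

section Forms

variable {R : Type*} [CommRing R] [CharZero R] {D : ℤ} {δ : R}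

theorem form_coords_unique (hD : D < 0) (hδ : δ ^ 2 = (D : R)) {a b : ℤ} (ha : a ≠ 0) {w : R}
    (hw : 2 * w = -(b : R) + δ) {u v u' v' : ℤ}
    (h : (u : R) * w + v * a = u' * w + v' * a) : u = u' ∧ v = v' := by
  have h1 : ((u - u' : ℤ) : R) * δ = (((u - u') * b + 2 * (v' - v) * a : ℤ) : R) := by
    push_cast
    linear_combination 2 * h - (u - u') * hw
  obtain ⟨h2, h3⟩ := eq_zero_of_int_mul_eq_int hD hδ h1
  rw [h2, zero_mul, zero_add] at h3
  have : v' - v = 0 := by simpa [ha] using h3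
  exact ⟨by linarith, by linarith⟩

theorem exists_coords_of_generator (hD : D < 0) (hδ : δ ^ 2 = (D : R)) {b b' : ℤ} {w w' : R}
    (hw : 2 * w = -(b : R) + δ) (hgen : ∀ x : R, ∃ m n : ℤ, x = m + n * w)
    (hw' : 2 * w' = -(b' : R) + δ) (x : R) : ∃ m n : ℤ, x = m + n * w' := by
  obtain ⟨k, l, hkl⟩ := hgen (w' - w)
  have h : (l : R) * δ = ((b - b' - 2 * k + l * b : ℤ) : R) := by
    push_cast
    linear_combination -2 * hkl + hw' - (l + 1) * hw
  have hl := (eq_zero_of_int_mul_eq_int hD hδ h).1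
  subst hl
  obtain ⟨m, n, hx⟩ := hgen x
  refine ⟨m - n * k, n, ?_⟩
  push_cast at hkl ⊢
  linear_combination hx - n * hkl

variable [IsDomain R]

theorem generator_quadratic_eq (hδ : δ ^ 2 = (D : R)) {b N : ℤ} {w : R}
    (hw : 2 * w = -(b : R) + δ) (hN : b ^ 2 - 4 * N = D) : w ^ 2 = -b * w - N := by
  have hN' : (b : R) ^ 2 - 4 * N = D := by exact_mod_cast congrArg (Int.cast (R := R)) hN
  have h4 : (4 : R) ≠ 0 := by norm_num
  refine mul_left_cancel₀ h4 ?_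
  linear_combination (2 * w + b + δ) * hw + hδ - hN'

theorem mem_span_form_iff (hδ : δ ^ 2 = (D : R)) {a b c : ℤ} {w : R}
    (hw : 2 * w = -(b : R) + δ) (hgen : ∀ x : R, ∃ m n : ℤ, x = m + n * w)
    (hdisc : b ^ 2 - 4 * a * c = D) {z : R} :
    z ∈ Ideal.span {w, (a : R)} ↔ ∃ u v : ℤ, z = u * w + v * a := by
  have hq := generator_quadratic_eq hδ hw (N := a * c) (by rw [← mul_assoc]; exact hdisc)
  push_cast at hq
  rw [Ideal.mem_span_pair]
  constructor
  · rintro ⟨x, y, rfl⟩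
    obtain ⟨m, n, rfl⟩ := hgen x
    obtain ⟨k, l, rfl⟩ := hgen y
    refine ⟨m - n * b + l * a, k - n * c, ?_⟩
    push_cast
    linear_combination n * hq
  · rintro ⟨u, v, rfl⟩
    exact ⟨u, v, rfl⟩

/-- Reduced forms whose ideals are equivalent agree. -/
theorem reduced_eq_of_span_mul_eq (hD : D < 0) (hδ : δ ^ 2 = (D : R)) {f g : ℤ × ℤ × ℤ}
    (hf : IsReducedForm D f) (hg : IsReducedForm D g) {w w' x y : R}
    (hw : 2 * w = -(f.2.1 : R) + δ) (hw' : 2 * w' = -(g.2.1 : R) + δ)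
    (hgen : ∀ z : R, ∃ m n : ℤ, z = m + n * w) (hx : x ≠ 0) (hy : y ≠ 0)
    (h : Ideal.span {x} * Ideal.span {w, (f.1 : R)} =
      Ideal.span {y} * Ideal.span {w', (g.1 : R)}) : f = g := by
  obtain ⟨a, b, c⟩ := f
  obtain ⟨a', b', c'⟩ := g
  obtain ⟨ha, hb, hc, hdisc, hbd⟩ := hf
  obtain ⟨ha', hb', hc', hdisc', hbd'⟩ := hg
  simp only at *
  have hgen' := exists_coords_of_generator hD hδ hw hgen hw'
  have forward : ∀ z ∈ Ideal.span {w, (a : R)}, ∃ u v : ℤ, x * z = y * (u * w' + v * a') := by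
    intro z hz
    obtain ⟨t, ht, hte⟩ := Ideal.mem_span_singleton_mul.mp
      (h ▸ Ideal.mul_mem_mul (Ideal.mem_span_singleton_self x) hz)
    obtain ⟨u, v, rfl⟩ := (mem_span_form_iff hδ hw' hgen' hdisc').mp ht
    exact ⟨u, v, hte.symm⟩
  have backward : ∀ z ∈ Ideal.span {w', (a' : R)}, ∃ u v : ℤ, y * z = x * (u * w + v * a) := by
    intro z hz
    obtain ⟨t, ht, hte⟩ := Ideal.mem_span_singleton_mul.mp
      (h.symm ▸ Ideal.mul_mem_mul (Ideal.mem_span_singleton_self y) hz)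
    obtain ⟨u, v, rfl⟩ := (mem_span_form_iff hδ hw hgen hdisc).mp ht
    exact ⟨u, v, hte.symm⟩
  obtain ⟨p, q, hpq⟩ := forward w (Ideal.subset_span (by simp))
  obtain ⟨r, s, hrs⟩ := forward a (Ideal.subset_span (by simp))
  obtain ⟨p', q', hpq'⟩ := backward w' (Ideal.subset_span (by simp))
  obtain ⟨r', s', hrs'⟩ := backward a' (Ideal.subset_span (by simp))
  have hdet : IsUnit (p * s - q * r) := by
    obtain ⟨e1, e2⟩ := form_coords_unique hD hδ ha.ne' hw (u := 1) (v := 0)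
      (u' := p * p' + q * r') (v' := p * q' + q * s') (by
        refine mul_left_cancel₀ hx ?_
        push_cast
        linear_combination hpq + p * hpq' + q * hrs')
    obtain ⟨e3, e4⟩ := form_coords_unique hD hδ ha.ne' hw (u := 0) (v := 1)
      (u' := r * p' + s * r') (v' := r * q' + s * s') (by
        refine mul_left_cancel₀ hx ?_
        push_cast
        linear_combination hrs + r * hpq' + s * hrs')
    refine IsUnit.of_mul_eq_one (p' * s' - q' * r') ?_
    have : (p * s - q * r) * (p' * s' - q' * r') =
      (p * p' + q * r') * (r * q' + s * s') - (p * q' + q * s') * (r * p' + s * r') := by ring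
    rw [this, ← e1, ← e2, ← e3, ← e4]
    norm_num
  have hq := generator_quadratic_eq hδ hw (N := a * c) (by rw [← mul_assoc]; exact hdisc)
  have hq' := generator_quadratic_eq hδ hw' (N := a' * c') (by rw [← mul_assoc]; exact hdisc')
  push_cast at hq hq'
  obtain ⟨h1, h2⟩ := form_coords_unique hD hδ ha'.ne' hw'
    (u := 2 * a * p + b * r) (v := 2 * a * q + b * s)
    (u' := 2 * a' * s - b' * r) (v' := b' * s - 2 * c' * r) (by
      refine mul_left_cancel₀ hy ?_
      push_cast
      linear_combination -2 * a * hpq + (2 * w' + b' - b) * hrs + x * a * hw - x * a * hw'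
        + 2 * r * y * hq')
  obtain ⟨h3, h4⟩ := form_coords_unique hD hδ ha'.ne' hw'
    (u := -b * p - 2 * c * r) (v := -b * q - 2 * c * s)
    (u' := 2 * a' * q - b' * p) (v' := b' * q - 2 * c' * p) (by
      refine mul_left_cancel₀ hy ?_
      push_cast
      linear_combination (2 * w' + b' + b) * hpq + 2 * c * hrs + x * w * hw - x * w * hw'
        + 2 * p * y * hq' - 2 * x * hq)
  obtain ⟨rfl, rfl, rfl⟩ := reduced_unique ha hb hc hbd ha' hb' hc' hbd'
    (hdisc.trans hdisc'.symm) hdet h1 h2 h3 h4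
  rfl

theorem span_form_mem_nonZeroDivisors {a : ℤ} (ha : a ≠ 0) (w : R) :
    Ideal.span {w, (a : R)} ∈ (Ideal R)⁰ := by
  rw [mem_nonZeroDivisors_iff_ne_zero]
  intro h
  have : (a : R) ∈ Ideal.span {w, (a : R)} := Ideal.subset_span (by simp)
  rw [h] at this
  exact ha (by simpa using this)

end Forms

section Classes

variable {R : Type*} [CommRing R] [IsDedekindDomain R] {D : ℤ} {δ : R}

/-- The positive definite form `(a, b, c)` of discriminant `D` has an ideal in the class `C`. -/
def RepresentsClass (D : ℤ) (δ : R) (C : ClassGroup R) (a b c : ℤ) : Prop :=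
  0 < a ∧ b ^ 2 - 4 * a * c = D ∧ ∃ (w : R) (h : Ideal.span {w, (a : R)} ∈ (Ideal R)⁰),
    2 * w = -(b : R) + δ ∧ ClassGroup.mk0 ⟨Ideal.span {w, (a : R)}, h⟩ = C

variable {C : ClassGroup R} {a b c : ℤ}

theorem RepresentsClass.translate (h : RepresentsClass D δ C a b c) (k : ℤ) :
    RepresentsClass D δ C a (b + 2 * a * k) (c + b * k + a * k ^ 2) := by
  obtain ⟨ha, hdisc, w, hI, hw, hC⟩ := h
  have hspan : Ideal.span {w + a * (-k : R), (a : R)} = Ideal.span {w, (a : R)} :=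
    Ideal.span_pair_add_right_mul _ _ _
  refine ⟨ha, by linear_combination hdisc, w + a * (-k : R), hspan ▸ hI, ?_, ?_⟩
  · push_cast
    linear_combination hw
  · simp_rw [hspan]
    exact hC

variable [CharZero R]

theorem RepresentsClass.swap (hD : D < 0) (hδ : δ ^ 2 = (D : R))
    (h : RepresentsClass D δ C a b c) : RepresentsClass D δ C c (-b) a := by
  obtain ⟨ha, hdisc, w, hI, hw, hC⟩ := h
  have hc : 0 < c := by
    by_contra! hc
    nlinarith [sq_nonneg b]
  have hq := generator_quadratic_eq hδ hw (N := a * c) (by rw [← mul_assoc]; exact hdisc)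
  push_cast at hq
  refine ⟨hc, by linear_combination hdisc, w + b,
    span_form_mem_nonZeroDivisors hc.ne' _, ?_, ?_⟩
  · push_cast
    linear_combination hw
  · rw [← hC, ClassGroup.mk0_eq_mk0_iff]
    have haR : (a : R) ≠ 0 := by exact_mod_cast ha.ne'
    have hcR : (c : R) ≠ 0 := by exact_mod_cast hc.ne'
    have hwb : w + b ≠ 0 := by
      intro h0
      have : (a : R) * c = 0 := by linear_combination hq - w * h0
      exact (mul_ne_zero haR hcR) this
    refine ⟨a, w + b, haR, hwb, ?_⟩
    simp only [Ideal.span_mul_span', Set.singleton_mul, Set.image_pair]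
    have : (w + b) * w = -((a : R) * c) := by linear_combination hq
    rw [this, Ideal.span_insert_neg, Ideal.span_pair_comm, mul_comm (w + (b : R))]

theorem exists_representsClass (hD : D < 0) (hδ : δ ^ 2 = (D : R)) {b N : ℤ} {w : R}
    (hw : 2 * w = -(b : R) + δ) (hN : b ^ 2 - 4 * N = D)
    (hgen : ∀ x : R, ∃ m n : ℤ, x = m + n * w) (C : ClassGroup R) :
    ∃ a b c, RepresentsClass D δ C a b c := by
  have hq := generator_quadratic_eq hδ hw hN
  obtain ⟨⟨I, hI⟩, rfl⟩ := ClassGroup.mk0_surjective C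
  let J : Ideal ℤ :=
    { carrier := {n | ∃ m : ℤ, (m + n * w : R) ∈ I}
      add_mem' := by
        rintro n n' ⟨m, hm⟩ ⟨m', hm'⟩
        refine ⟨m + m', ?_⟩
        convert I.add_mem hm hm' using 1
        push_cast
        ring
      zero_mem' := ⟨0, by simp⟩
      smul_mem' := by
        rintro l n ⟨m, hm⟩
        refine ⟨l * m, ?_⟩
        convert I.mul_mem_left l hm using 1
        simp only [smul_eq_mul]
        push_cast
        ring }
  obtain ⟨n, hn⟩ := (IsPrincipalIdealRing.principal J).principal
  obtain ⟨m, hm⟩ := (IsPrincipalIdealRing.principal (I.comap (Int.castRingHom R))).principal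
  have hJ : ∀ {k l : ℤ}, (k + l * w : R) ∈ I → n ∣ l := by
    intro k l h
    have : l ∈ J := ⟨k, h⟩
    rw [hn] at this
    exact Ideal.mem_span_singleton.mp this
  have hZ : ∀ {k : ℤ}, (k : R) ∈ I ↔ m ∣ k := by
    intro k
    have : k ∈ I.comap (Int.castRingHom R) ↔ m ∣ k := by
      rw [hm]
      exact Ideal.mem_span_singleton
    simpa using this
  have hmI : (m : R) ∈ I := hZ.mpr dvd_rfl
  have hm0 : m ≠ 0 := by
    rintro rfl
    refine nonZeroDivisors.ne_zero hI (le_bot_iff.mp fun x hx => ?_)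
    obtain ⟨k, l, rfl⟩ := hgen x
    have h1 : ((k ^ 2 - b * k * l + N * l ^ 2 : ℤ) : R) ∈ I := by
      have := I.mul_mem_left (k + l * (-b - w)) hx
      convert this using 1
      push_cast
      linear_combination l ^ 2 * hq
    have h2 := zero_dvd_iff.mp (hZ.mp h1)
    have hl : l = 0 := by
      by_contra hl
      have : 0 < l ^ 2 := by positivity
      nlinarith [sq_nonneg (2 * k - b * l)]
    subst hl
    have hk : k = 0 := by simpa using h2
    simp [hk]
  obtain ⟨a, rfl⟩ : n ∣ m := hJ (k := 0) (by
    rw [Int.cast_zero, zero_add, mul_comm]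
    exact I.mul_mem_left w hmI)
  obtain ⟨hn0, ha0⟩ := mul_ne_zero_iff.mp hm0
  obtain ⟨x₀, hx₀⟩ : n ∈ J := hn ▸ Ideal.mem_span_singleton_self n
  obtain ⟨k, rfl⟩ : n ∣ x₀ := by
    have h1 : n ∣ x₀ - n * b := hJ (k := -n * N) (by
      convert I.mul_mem_left w hx₀ using 1
      push_cast
      linear_combination -n * hq)
    have := h1.add (dvd_mul_right n b)
    rwa [sub_add_cancel] at this
  obtain ⟨c, hc⟩ : a ∣ k ^ 2 - b * k + N := by
    refine (mul_dvd_mul_iff_left hn0).mp (hZ.mp ?_)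
    convert I.mul_mem_left (k + (-b - w)) hx₀ using 1
    push_cast
    linear_combination n * hq
  have hIeq : I = Ideal.span {(n : R)} * Ideal.span {w + k, (a : R)} := by
    apply le_antisymm
    · intro z hz
      obtain ⟨x, y, rfl⟩ := hgen z
      obtain ⟨y, rfl⟩ := hJ hz
      obtain ⟨t, ht⟩ : n * a ∣ x - y * (n * k) := by
        refine hZ.mp ?_
        convert I.sub_mem hz (I.mul_mem_left y hx₀) using 1
        push_cast
        ring
      refine Ideal.mem_span_singleton_mul.mpr
        ⟨y * (w + k) + t * a, Ideal.mem_span_pair.mpr ⟨y, t, rfl⟩, ?_⟩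
      have : (x : R) - y * (n * k) = n * a * t := by
        exact_mod_cast congrArg (Int.cast (R := R)) ht
      push_cast
      linear_combination -this
    · rw [Ideal.span_mul_span', Set.singleton_mul, Set.image_pair, Ideal.span_le,
        Set.pair_subset_iff]
      constructor
      · rw [SetLike.mem_coe]
        convert hx₀ using 1
        push_cast
        ring
      · exact_mod_cast hmI
  have hrep : ∀ a' : ℤ, 0 < a' → Ideal.span {w + k, (a' : R)} = Ideal.span {w + k, (a : R)} →
      ∀ c', a' * c' = a * c → RepresentsClass D δ (ClassGroup.mk0 ⟨I, hI⟩) a' (b - 2 * k) c' := by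
    intro a' ha' hs c' hc'
    refine ⟨ha', by linear_combination hN + 4 * hc - 4 * hc', w + k,
      span_form_mem_nonZeroDivisors ha'.ne' _, ?_, ?_⟩
    · push_cast
      linear_combination hw
    · rw [ClassGroup.mk0_eq_mk0_iff]
      refine ⟨n, 1, by exact_mod_cast hn0, one_ne_zero, ?_⟩
      change Ideal.span {(n : R)} * Ideal.span {w + k, (a' : R)} = Ideal.span {1} * I
      rw [hs, Ideal.span_singleton_one, Ideal.top_mul, ← hIeq]
  rcases lt_or_gt_of_ne ha0 with ha | ha
  · exact ⟨-a, _, -c, hrep (-a) (by linarith)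
      (by rw [Int.cast_neg, Ideal.span_pair_neg])
      (-c) (by ring)⟩
  · exact ⟨a, _, c, hrep a ha rfl c rfl⟩

theorem exists_reduced_representsClass (hD : D < 0) (hδ : δ ^ 2 = (D : R))
    (hex : ∃ a b c, RepresentsClass D δ C a b c) :
    ∃ f, IsReducedForm D f ∧ RepresentsClass D δ C f.1 f.2.1 f.2.2 := by
  classical
  have hex' : ∃ n : ℕ, ∃ b c, RepresentsClass D δ C n b c := by
    obtain ⟨a, b, c, h⟩ := hex
    lift a to ℕ using h.1.le
    exact ⟨a, b, c, h⟩
  have hmin : ∀ {a b c : ℤ}, RepresentsClass D δ C a b c → (Nat.find hex' : ℤ) ≤ a := by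
    intro a b c h
    lift a to ℕ using h.1.le
    exact_mod_cast Nat.find_min' hex' ⟨b, c, h⟩
  obtain ⟨b₀, c₀, h₀⟩ := Nat.find_spec hex'
  generalize (Nat.find hex' : ℤ) = a at h₀ hmin
  have ha := h₀.1
  obtain ⟨b, c, hb1, hb2, h⟩ : ∃ b c : ℤ, -a < b ∧ b ≤ a ∧ RepresentsClass D δ C a b c := by
    refine ⟨_, _, ?_, ?_, h₀.translate (-((b₀ + a - 1) / (2 * a)))⟩
    all_goals
      have e1 := Int.emod_nonneg (b₀ + a - 1) (show 2 * a ≠ 0 by linarith)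
      have e2 := Int.emod_lt_of_pos (b₀ + a - 1) (show 0 < 2 * a by linarith)
      have e3 := Int.mul_ediv_add_emod (b₀ + a - 1) (2 * a)
      linarith
  have hswap := h.swap hD hδ
  have hac := hmin hswap
  by_cases hneg : a = c ∧ b < 0
  · obtain ⟨rfl, hb⟩ := hneg
    exact ⟨(a, -b, a), ⟨ha, abs_le.mpr ⟨by simp; linarith, by simp; linarith⟩, le_rfl,
      hswap.2.1, fun _ => by simp; linarith⟩, hswap⟩
  · refine ⟨(a, b, c), ⟨ha, abs_le.mpr ⟨hb1.le, hb2⟩, hac, h.2.1, ?_⟩, h⟩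
    rintro (he | he)
    · simp only at he ⊢
      rcases abs_cases b with ⟨e, h1⟩ | ⟨e, h1⟩
      · exact h1
      · linarith
    · by_contra! hb
      exact hneg ⟨he, hb⟩

end Classes

/-- Let `D < 0` be a fundamental discriminant and `K = ℚ(√D)`, i.e. the imaginary
quadratic field of discriminant `D`.  The map sending a reduced form `(a,b,c)` of
discriminant `D` to the class of the ideal `ℤ·((-b+√D)/2) + ℤ·a` is a bijection between
the reduced forms of discriminant `D` and the ideal class group `Cl_K`. -/
theorem reduced_forms_biject_with_class_group
    (D : ℤ) (hD : D < 0) (hfund : IsFundamentalDiscriminant D)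
    (K : Type*) [Field K] [NumberField K] (hdeg : Module.finrank ℚ K = 2)
    (hdisc : NumberField.discr K = D)
    (δ : 𝓞 K) (hδ : δ ^ 2 = (D : 𝓞 K)) :
    ∃ F : {f : ℤ × ℤ × ℤ // IsReducedForm D f} → ClassGroup (𝓞 K),
      Function.Bijective F ∧
      ∀ (f : {f : ℤ × ℤ × ℤ // IsReducedForm D f}) (w : 𝓞 K),
        2 * w = -(f.1.2.1 : 𝓞 K) + δ →
        ∀ h : Ideal.span ({w, (f.1.1 : 𝓞 K)} : Set (𝓞 K)) ∈ (Ideal (𝓞 K))⁰,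
          F f = ClassGroup.mk0 ⟨Ideal.span ({w, (f.1.1 : 𝓞 K)} : Set (𝓞 K)), h⟩ := by
  obtain ⟨b₀, N, w₀, hw₀, hN, hgen⟩ := exists_integral_generator hdeg hD hfund hδ
  have hw : ∀ f : {f : ℤ × ℤ × ℤ // IsReducedForm D f},
      ∃ w : 𝓞 K, 2 * w = -(f.1.2.1 : 𝓞 K) + δ := by
    rintro ⟨⟨a, b, c⟩, -, -, -, (hdisc : b ^ 2 - 4 * a * c = D), -⟩
    change ∃ w : 𝓞 K, 2 * w = -(b : 𝓞 K) + δ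
    obtain ⟨k, hk⟩ : (2 : ℤ) ∣ b₀ - b := by
      have : Even ((b₀ - b) ^ 2) :=
        ⟨2 * N - 2 * a * c - b * (b₀ - b), by linear_combination hN - hdisc⟩
      exact (Int.even_pow.mp this).1.two_dvd
    refine ⟨w₀ + k, ?_⟩
    have hkR : (b₀ : 𝓞 K) - b = 2 * k := by exact_mod_cast congrArg (Int.cast (R := 𝓞 K)) hk
    linear_combination hw₀ - hkR
  choose W hW using hw
  have huniq : ∀ (f : {f : ℤ × ℤ × ℤ // IsReducedForm D f}) (w : 𝓞 K),
      2 * w = -(f.1.2.1 : 𝓞 K) + δ → W f = w := fun f w h =>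
    mul_left_cancel₀ two_ne_zero ((hW f).trans h.symm)
  refine ⟨fun f => ClassGroup.mk0
    ⟨Ideal.span {W f, (f.1.1 : 𝓞 K)}, span_form_mem_nonZeroDivisors f.2.1.ne' _⟩,
    ⟨fun f g hfg => ?_, fun C => ?_⟩, fun f w h hI => ?_⟩
  · obtain ⟨x, y, hx, hy, hxy⟩ := ClassGroup.mk0_eq_mk0_iff.mp hfg
    exact Subtype.ext (reduced_eq_of_span_mul_eq hD hδ f.2 g.2 (hW f) (hW g)
      (exists_coords_of_generator hD hδ hw₀ hgen (hW f)) hx hy hxy)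
  · obtain ⟨f, hf, _, _, w, hI, h, hC⟩ :=
      exists_reduced_representsClass hD hδ (exists_representsClass hD hδ hw₀ hN hgen C)
    refine ⟨⟨f, hf⟩, ?_⟩
    simp only [huniq ⟨f, hf⟩ w h]
    exact hC
  · simp only [huniq f w h]
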